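/- arXiv:2104.00822 — 8 statements merged into one kernel-verified Lean document; each statement's English description precedes it below -/
import Mathlib

section
/- Let ins and outs be finite lists of pairs (v, r) of elements of ZMod n (the values and blinding factors of the inputs and outputs), let tko : ZMod n be the kernel offset, and define the transaction excess ke = ((Σ_{(v,r)∈outs} r) − (Σ_{(v,r)∈ins} r) − tko) • G. If the output values sum to the input values, i.e. Σ_{(v,r)∈outs} v = Σ_{(v,r)∈ins} v, then the transaction is balanced: (Σ_{(v,r)∈outs} Com(v,r)) − (Σ_{(v,r)∈ins} Com(v,r)) = ke + tko • G. -/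
/-- Pedersen commitment: `Com G H v r = r • G + v • H`. -/
def Com {n : ℕ} {C : Type*} [AddCommGroup C] [Module (ZMod n) C]
    (G H : C) (v r : ZMod n) : C := r • G + v • H

/-- A sum of Pedersen commitments is the commitment to the sums. -/
theorem sum_map_Com {n : ℕ} {C : Type*} [AddCommGroup C] [Module (ZMod n) C]
    (G H : C) (l : List (ZMod n × ZMod n)) :
    (l.map fun p => Com G H p.1 p.2).sum =
      Com G H (l.map fun p => p.1).sum (l.map fun p => p.2).sum := by
  induction l with
  | nil => simp [Com]
  | cons p l ih =>
    simp only [List.map_cons, List.sum_cons, ih]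
    simp only [Com, add_smul]
    abel

theorem balanced_of_values_sum_eq (n : ℕ) (C : Type*) [AddCommGroup C]
    [Module (ZMod n) C] (G H : C) (ins outs : List (ZMod n × ZMod n)) (tko : ZMod n)
    (ke : C)
    (hke : ke = ((outs.map fun p => p.2).sum - (ins.map fun p => p.2).sum - tko) • G)
    (hv : (outs.map fun p => p.1).sum = (ins.map fun p => p.1).sum) :
    (outs.map fun p => Com G H p.1 p.2).sum - (ins.map fun p => Com G H p.1 p.2).sum =
      ke + tko • G := by
  rw [sum_map_Com, sum_map_Com, hke, hv, Com, Com, ← add_smul, sub_add_cancel, sub_smul]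
  abel
end

section
/- (No Coin Inflation, weak form) Let ins and outs be finite lists of pairs (v, r) of elements of ZMod n (the values and blinding factors of the inputs and outputs), let tko : ZMod n be the kernel offset, and define the transaction excess ke = ((Σ_{(v,r)∈outs} r) − (Σ_{(v,r)∈ins} r) − tko) • G. If the transaction is balanced, i.e. (Σ_{(v,r)∈outs} Com(v,r)) − (Σ_{(v,r)∈ins} Com(v,r)) = ke + tko • G, then ((Σ_{(v,r)∈outs} v) − (Σ_{(v,r)∈ins} v)) • H = 0. -/
theorem no_coin_inflation_weak (n : ℕ) (C : Type*) [AddCommGroup C]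
    [Module (ZMod n) C] (G H : C) (ins outs : List (ZMod n × ZMod n)) (tko : ZMod n)
    (ke : C)
    (hke : ke = ((outs.map fun p => p.2).sum - (ins.map fun p => p.2).sum - tko) • G)
    (hbal : (outs.map fun p => Com G H p.1 p.2).sum - (ins.map fun p => Com G H p.1 p.2).sum =
      ke + tko • G) :
    ((outs.map fun p => p.1).sum - (ins.map fun p => p.1).sum) • H = 0 := by
  rw [sum_map_Com, sum_map_Com, hke, Com, Com, ← sub_eq_zero] at hbal
  rw [← hbal]
  module
end

section
/- (No Coin Inflation) Let ins and outs be finite lists of pairs (v, r) of elements of ZMod n (the values and blinding factors of the inputs and outputs), let tko : ZMod n be the kernel offset, and define the transaction excess ke = ((Σ_{(v,r)∈outs} r) − (Σ_{(v,r)∈ins} r) − tko) • G. Assume that H has full order, i.e. for every x : ZMod n, x • H = 0 implies x = 0. If the transaction is balanced, i.e. (Σ_{(v,r)∈outs} Com(v,r)) − (Σ_{(v,r)∈ins} Com(v,r)) = ke + tko • G, then no money is created from thin air: Σ_{(v,r)∈outs} v = Σ_{(v,r)∈ins} v. -/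
theorem no_coin_inflation (n : ℕ) (C : Type*) [AddCommGroup C]
    [Module (ZMod n) C] (G H : C)
    (hH : ∀ x : ZMod n, x • H = 0 → x = 0)
    (ins outs : List (ZMod n × ZMod n)) (tko : ZMod n) (ke : C)
    (hke : ke = ((outs.map fun p => p.2).sum - (ins.map fun p => p.2).sum - tko) • G)
    (hbal : (outs.map fun p => Com G H p.1 p.2).sum - (ins.map fun p => Com G H p.1 p.2).sum =
      ke + tko • G) :
    (outs.map fun p => p.1).sum = (ins.map fun p => p.1).sum := by
  rw [sum_map_Com, sum_map_Com, hke, ← add_smul, sub_add_cancel, sub_smul, Com, Com,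
    add_sub_add_comm, add_eq_left, ← sub_smul] at hbal
  exact sub_eq_zero.mp (hH _ hbal)
end

section
/- Let ts be a finite list of single transactions, each consisting of a list of inputs, a list of outputs (lists of elements of C), a transaction excess in C, and a kernel offset in ZMod n, and suppose every transaction in ts is balanced. Then the block obtained by aggregating all of them — whose input list is the concatenation of all input lists, whose output list is the concatenation of all output lists, whose excess list is the list of all transaction excesses, and whose block kernel offset is the sum of all kernel offsets — is balanced. -/
/-- A single transaction: inputs, outputs, transaction excess and kernel offset. -/
structure Tx (n : ℕ) (C : Type*) where
  ins : List C
  outs : List C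
  ke : C
  tko : ZMod n

theorem block_of_balanced_transactions (n : ℕ) (C : Type*) [AddCommGroup C]
    [Module (ZMod n) C] (G : C) (ts : List (Tx n C))
    (hbal : ∀ t ∈ ts, t.outs.sum - t.ins.sum = t.ke + t.tko • G) :
    ((ts.map Tx.outs).flatten).sum - ((ts.map Tx.ins).flatten).sum =
      ((ts.map Tx.tko).sum) • G + (ts.map Tx.ke).sum := by
  induction ts with
  | nil => simp
  | cons t ts ih =>
    have ht := hbal t List.mem_cons_self
    have hts := ih fun s hs => hbal s (List.mem_cons_of_mem t hs)
    simp only [List.map_cons, List.flatten_cons, List.sum_append, List.sum_cons, add_smul]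
    rw [add_sub_add_comm, ht, hts]
    abel
end

section
/- (Invariant: Cut-through Block Validity, balance part) Let b be a block with input multiset i, output multiset o, excess multiset kes and block kernel offset ko : ZMod n, and let b' be the block obtained from b by the cut-through process: its inputs are i' = i − (i ∩ o) and its outputs are o' = o − (i ∩ o), where ∩ denotes multiset intersection and − denotes multiset difference, while kes and ko are unchanged. If b is balanced, then b' is balanced. -/
theorem Multiset.sum_sub_of_le {C : Type*} [AddCommGroup C] [DecidableEq C]
    {s t : Multiset C} (h : t ≤ s) : (s - t).sum = s.sum - t.sum := by
  rw [eq_sub_iff_add_eq, ← Multiset.sum_add, tsub_add_cancel_of_le h]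

theorem cutthrough_block_validity (n : ℕ) (C : Type*) [AddCommGroup C]
    [Module (ZMod n) C] [DecidableEq C] (G : C)
    (i o : Multiset C) (kes : Multiset C) (ko : ZMod n)
    (hb : o.sum - i.sum = ko • G + kes.sum) :
    (o - (i ∩ o)).sum - (i - (i ∩ o)).sum = ko • G + kes.sum := by
  rw [Multiset.sum_sub_of_le Multiset.inter_le_right,
    Multiset.sum_sub_of_le Multiset.inter_le_left, sub_sub_sub_cancel_right, hb]
end

section
/- (Discrete-log extraction from a binding break) Assume n is prime. Let v1, r1, v2, r2 : ZMod n be two openings producing the same Pedersen commitment, i.e. Com(v1, r1) = Com(v2, r2), and assume v1 ≠ v2. Then the discrete logarithm of H with respect to G can be computed: H = ((r1 − r2) / (v2 − v1)) • G. -/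
theorem dlog_from_binding_break (n : ℕ) [Fact n.Prime] (C : Type*) [AddCommGroup C]
    [Module (ZMod n) C] (G H : C) (v1 r1 v2 r2 : ZMod n)
    (hcom : Com G H v1 r1 = Com G H v2 r2) (hne : v1 ≠ v2) :
    H = ((r1 - r2) / (v2 - v1)) • G := by
  have hv : v2 - v1 ≠ 0 := sub_ne_zero.mpr hne.symm
  have key : (v2 - v1) • H = (r1 - r2) • G := by
    rw [sub_smul, sub_smul, sub_eq_sub_iff_add_eq_add, add_comm, add_comm (r1 • G)]
    simpa [Com, add_comm] using hcom.symm
  rw [div_eq_inv_mul, mul_smul, ← key, inv_smul_smul₀ hv]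
end

section
/- (Pedersen commitments are binding when the discrete log of H in base G is unknown) Assume n is prime and that H is not a ZMod n-multiple of G, i.e. for every x : ZMod n, H ≠ x • G. Then the Pedersen commitment scheme is binding: for all v1, r1, v2, r2 : ZMod n, if Com(v1, r1) = Com(v2, r2) then v1 = v2 and r1 • G = r2 • G. -/
theorem pedersen_binding (n : ℕ) [Fact n.Prime] (C : Type*) [AddCommGroup C]
    [Module (ZMod n) C] (G H : C)
    (hH : ∀ x : ZMod n, H ≠ x • G) :
    ∀ v1 r1 v2 r2 : ZMod n, Com G H v1 r1 = Com G H v2 r2 →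
      v1 = v2 ∧ r1 • G = r2 • G := by
  intro v1 r1 v2 r2 h
  unfold Com at h
  have hv : v1 = v2 := by
    by_contra hne
    have hd : v1 - v2 ≠ 0 := sub_ne_zero.mpr hne
    have key : (v1 - v2) • H = (r2 - r1) • G := by
      rw [sub_smul, sub_smul, sub_eq_sub_iff_add_eq_add, add_comm, h]
    apply hH ((v1 - v2)⁻¹ * (r2 - r1))
    rw [mul_smul, ← key, inv_smul_smul₀ hd]
  subst hv
  exact ⟨rfl, add_right_cancel h⟩
end

section
/- (Pedersen commitments are perfectly hiding) Assume n > 0 and that H = k • G for some k : ZMod n. Then the distribution of a Pedersen commitment with a uniformly random blinding factor does not depend on the committed value: for all v1, v2 : ZMod n, the pushforward of the uniform probability distribution on ZMod n under the map r ↦ Com(v1, r) equals the pushforward of the uniform probability distribution on ZMod n under the map r ↦ Com(v2, r). -/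
/-- The uniform distribution on a finite type is invariant under permutations. -/
theorem PMF.map_equiv_uniformOfFintype {α : Type*} [Fintype α] [Nonempty α] (e : α ≃ α) :
    (PMF.uniformOfFintype α).map e = PMF.uniformOfFintype α := by
  classical
  ext a
  rw [PMF.map_apply, tsum_eq_single (e.symm a)]
  · simp
  · intro b hb
    exact if_neg fun h => hb (by simp [h])

/-- If `H = k • G`, changing the committed value amounts to translating the blinding factor. -/
theorem Com_eq_Com_add {n : ℕ} {C : Type*} [AddCommGroup C] [Module (ZMod n) C]
    {G H : C} {k : ZMod n} (hH : H = k • G) (v1 v2 r : ZMod n) :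
    Com G H v1 r = Com G H v2 (r + (v1 - v2) * k) := by
  simp only [Com, hH]
  module

theorem pedersen_perfectly_hiding (n : ℕ) [NeZero n] (C : Type*) [AddCommGroup C]
    [Module (ZMod n) C] (G H : C)
    (k : ZMod n) (hH : H = k • G) (v1 v2 : ZMod n) :
    (PMF.uniformOfFintype (ZMod n)).map (fun r => Com G H v1 r) =
      (PMF.uniformOfFintype (ZMod n)).map (fun r => Com G H v2 r) := by
  conv_rhs => rw [← PMF.map_equiv_uniformOfFintype (Equiv.addRight ((v1 - v2) * k)), PMF.map_comp]
  exact congrArg (PMF.map · _) (funext (Com_eq_Com_add hH v1 v2))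
end
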